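/- Let W, W̃ ∈ ℝ^{d×r} have orthonormal columns w_1, ..., w_r and w̃_1, ..., w̃_r respectively. Then ‖W W^T − W̃ W̃^T‖₂ ≤ Σ_{i=1}^r √(1 − ⟨w_i, w̃_i⟩²), where ‖·‖₂ denotes the spectral norm. -/

import Mathlib

open Matrix

/-- The spectral norm (largest singular value) of a real matrix, realised as the operator norm
of the associated linear map between Euclidean spaces. -/
noncomputable def spec {m n : ℕ} (A : Matrix (Fin m) (Fin n) ℝ) : ℝ :=
  ‖LinearMap.toContinuousLinearMap (Matrix.toEuclideanLin A)‖

/-- For unit vectors `u`, `v` with inner product `c`, the difference of the orthogonal projections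
onto the lines they span has operator norm at most `√(1 - c²)`. -/
theorem norm_inner_smul_sub_inner_smul_le {E : Type*} [NormedAddCommGroup E]
    [InnerProductSpace ℝ E] {u v : E} (hu : ‖u‖ = 1) (hv : ‖v‖ = 1) (x : E) :
    ‖inner ℝ u x • u - inner ℝ v x • v‖ ≤ Real.sqrt (1 - inner ℝ u v ^ 2) * ‖x‖ := by
  have huu : inner ℝ u u = 1 := by rw [real_inner_self_eq_norm_sq, hu, one_pow]
  have hvv : inner ℝ v v = 1 := by rw [real_inner_self_eq_norm_sq, hv, one_pow]
  -- Cauchy–Schwarz for the components of `u` and `x` orthogonal to `v`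
  have key := real_inner_mul_inner_self_le (u - inner ℝ u v • v) (x - inner ℝ v x • v)
  have hsq : ‖inner ℝ u x • u - inner ℝ v x • v‖ ^ 2 ≤ (1 - inner ℝ u v ^ 2) * ‖x‖ ^ 2 := by
    rw [← real_inner_self_eq_norm_sq, ← real_inner_self_eq_norm_sq]
    simp only [inner_sub_left, inner_sub_right, real_inner_smul_left, real_inner_smul_right,
      huu, hvv, real_inner_comm u v, real_inner_comm v x] at key ⊢
    nlinarith [key]
  rw [← Real.sqrt_sq (norm_nonneg x), ← Real.sqrt_mul' _ (sq_nonneg _)]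
  exact Real.le_sqrt_of_sq_le hsq

/-- `W Wᵀ` acts as the sum over the columns `w` of `W` of the maps `x ↦ ⟨w, x⟩ w`. -/
theorem toEuclideanLin_mul_transpose_apply {m n : Type*} [Fintype m] [Fintype n] [DecidableEq m]
    (W : Matrix m n ℝ) (x : EuclideanSpace ℝ m) :
    Matrix.toEuclideanLin (W * Wᵀ) x =
      ∑ i, inner ℝ (WithLp.toLp 2 (Wᵀ i)) x • WithLp.toLp 2 (Wᵀ i) := by
  ext j
  simp [Matrix.toLpLin_apply, ← Matrix.mulVec_mulVec, PiLp.inner_apply, Matrix.mulVec,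
    dotProduct, mul_comm]

theorem norm_toLp_transpose_eq_one {m n : Type*} [Fintype m] [DecidableEq n]
    {W : Matrix m n ℝ} (hW : Wᵀ * W = 1) (i : n) : ‖WithLp.toLp 2 (Wᵀ i)‖ = 1 := by
  have h := congrFun₂ hW i i
  rw [Matrix.one_apply_eq, Matrix.mul_apply] at h
  rw [EuclideanSpace.norm_eq, Real.sqrt_eq_one, ← h]
  simp [sq]

/-- Let `W, W̃ ∈ ℝ^{d×r}` have orthonormal columns `w_1, ..., w_r` and `w̃_1, ..., w̃_r`.
Then `‖W Wᵀ − W̃ W̃ᵀ‖₂ ≤ Σ_{i=1}^r √(1 − ⟨w_i, w̃_i⟩²)`. -/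
theorem projection_diff_spec_norm_le_sum {d r : ℕ}
    (W W' : Matrix (Fin d) (Fin r) ℝ)
    (hW : Wᵀ * W = 1) (hW' : W'ᵀ * W' = 1) :
    spec (W * Wᵀ - W' * W'ᵀ) ≤
      ∑ i : Fin r, Real.sqrt (1 - ((fun j => W j i) ⬝ᵥ (fun j => W' j i)) ^ 2) := by
  refine ContinuousLinearMap.opNorm_le_bound _ (Finset.sum_nonneg fun i _ => Real.sqrt_nonneg _)
    fun x => ?_
  rw [LinearMap.coe_toContinuousLinearMap', map_sub, LinearMap.sub_apply,
    toEuclideanLin_mul_transpose_apply, toEuclideanLin_mul_transpose_apply,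
    ← Finset.sum_sub_distrib, Finset.sum_mul]
  refine norm_sum_le_of_le _ fun i _ => ?_
  have h := norm_inner_smul_sub_inner_smul_le (norm_toLp_transpose_eq_one hW i)
    (norm_toLp_transpose_eq_one hW' i) x
  have hinner : inner ℝ (WithLp.toLp 2 (Wᵀ i)) (WithLp.toLp 2 (W'ᵀ i)) =
      (fun j => W j i) ⬝ᵥ (fun j => W' j i) := by
    simp [PiLp.inner_apply, dotProduct, mul_comm]
  rwa [hinner] at h
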